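/- arXiv:2305.16621 — 3 statements merged into one kernel-verified Lean document; each statement's English description precedes it below -/
import Mathlib

section
/- Let γ be a real number with 0 < γ < 1, let Φ : ℕ → ℝ be a bounded sequence, and let φ₋₁ ∈ ℝ. Define the shaping reward sequence F : ℕ → ℝ by F 0 = Φ 0 − γ⁻¹·φ₋₁ and F (t+1) = Φ (t+1) − γ⁻¹·Φ t. Then the series ∑_{t=0}^{∞} γ^t · F t converges (HasSum) and its sum equals −γ⁻¹ · φ₋₁. -/
/-- For `0 < γ < 1`, bounded `Φ`, and shaping rewards
`F 0 = Φ 0 - γ⁻¹ * φneg1`, `F (t+1) = Φ (t+1) - γ⁻¹ * Φ t`,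
the discounted series `∑_{t=0}^∞ γ^t * F t` has sum `-γ⁻¹ * φneg1`. -/
theorem discounted_shaping_reward_hasSum
    (γ : ℝ) (hγ0 : 0 < γ) (hγ1 : γ < 1) (Φ : ℕ → ℝ)
    (hΦ : ∃ C : ℝ, ∀ t : ℕ, |Φ t| ≤ C) (φneg1 : ℝ) (F : ℕ → ℝ)
    (hF0 : F 0 = Φ 0 - γ⁻¹ * φneg1)
    (hFsucc : ∀ t : ℕ, F (t + 1) = Φ (t + 1) - γ⁻¹ * Φ t) :
    HasSum (fun t : ℕ => γ ^ t * F t) (-γ⁻¹ * φneg1) := by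
  obtain ⟨C, hC⟩ := hΦ
  have hsum : Summable fun t : ℕ => γ ^ t * Φ t := by
    refine Summable.of_norm_bounded
      ((summable_geometric_of_lt_one hγ0.le hγ1).mul_right C) fun t => ?_
    rw [Real.norm_eq_abs, abs_mul, abs_of_pos (pow_pos hγ0 t)]
    exact mul_le_mul_of_nonneg_left (hC t) (pow_pos hγ0 t).le
  have hshift := (hasSum_nat_add_iff' 1).mpr hsum.hasSum
  rw [← hasSum_nat_add_iff' 1]
  convert hshift.sub hsum.hasSum using 1
  · funext t
    rw [hFsucc, pow_succ]
    field_simp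
  · simp only [Finset.sum_range_one, pow_zero, one_mul, hF0]
    ring
end

section
/- Let γ be a real number with 0 < γ < 1, let R : ℕ → ℝ be such that t ↦ γ^t · R t is summable, let Φ : ℕ → ℝ be a bounded sequence, and let φ₋₁ ∈ ℝ. Define the shaping reward sequence F : ℕ → ℝ by F 0 = Φ 0 − γ⁻¹·φ₋₁ and F (t+1) = Φ (t+1) − γ⁻¹·Φ t. Then t ↦ γ^t · (R t + F t) is summable and ∑_{t=0}^{∞} γ^t · (R t + F t) = (∑_{t=0}^{∞} γ^t · R t) − γ⁻¹ · φ₋₁; that is, the shaped discounted return equals the original discounted return shifted by the constant −γ⁻¹φ₋₁. -/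
/-- A bounded real sequence has a summable discounted series. -/
theorem summable_geometric_mul_of_bounded {γ : ℝ} (hγ0 : 0 ≤ γ) (hγ1 : γ < 1) {Φ : ℕ → ℝ}
    (hΦ : ∃ C : ℝ, ∀ t : ℕ, |Φ t| ≤ C) : Summable (fun t : ℕ => γ ^ t * Φ t) := by
  obtain ⟨C, hC⟩ := hΦ
  refine Summable.of_norm_bounded ((summable_geometric_of_lt_one hγ0 hγ1).mul_right C) fun t => ?_
  rw [norm_mul, Real.norm_of_nonneg (pow_nonneg hγ0 t)]
  exact mul_le_mul_of_nonneg_left (hC t) (pow_nonneg hγ0 t)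

/-- The shaped discounted return equals the original discounted return
shifted by the constant `-γ⁻¹ * φneg1`. -/
theorem shaped_return_eq_return_sub_const
    (γ : ℝ) (hγ0 : 0 < γ) (hγ1 : γ < 1) (R : ℕ → ℝ)
    (hR : Summable (fun t : ℕ => γ ^ t * R t)) (Φ : ℕ → ℝ)
    (hΦ : ∃ C : ℝ, ∀ t : ℕ, |Φ t| ≤ C) (φneg1 : ℝ) (F : ℕ → ℝ)
    (hF0 : F 0 = Φ 0 - γ⁻¹ * φneg1)
    (hFsucc : ∀ t : ℕ, F (t + 1) = Φ (t + 1) - γ⁻¹ * Φ t) :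
    Summable (fun t : ℕ => γ ^ t * (R t + F t)) ∧
      ∑' t : ℕ, γ ^ t * (R t + F t)
        = (∑' t : ℕ, γ ^ t * R t) - γ⁻¹ * φneg1 := by
  have hG := summable_geometric_mul_of_bounded hγ0.le hγ1 hΦ
  have hshift := (hasSum_nat_add_iff' 1).mpr hG.hasSum
  have hF : HasSum (fun t : ℕ => γ ^ t * F t) (-(γ⁻¹ * φneg1)) := by
    rw [← hasSum_nat_add_iff' 1]
    convert hshift.sub hG.hasSum using 1
    · funext t
      rw [hFsucc, pow_succ]
      field_simp
    · simp only [hF0, Finset.sum_range_one, pow_zero, one_mul]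
      ring
  have h : HasSum (fun t : ℕ => γ ^ t * (R t + F t))
      ((∑' t : ℕ, γ ^ t * R t) - γ⁻¹ * φneg1) := by
    simpa only [mul_add, sub_eq_add_neg] using hR.hasSum.add hF
  exact ⟨h.summable, h.tsum_eq⟩
end

section
/- Let Π be a nonempty set (of deterministic policies), let γ ∈ ℝ with 0 < γ < 1, and let φ₀ ∈ ℝ. For each π ∈ Π let R π : ℕ → ℝ be such that t ↦ γ^t · R π t is summable, and let Φ π : ℕ → ℝ be bounded; define the shaped reward sequence F π : ℕ → ℝ by F π 0 = Φ π 0 − γ⁻¹·φ₀ and F π (t+1) = Φ π (t+1) − γ⁻¹·Φ π t. Let V π = ∑_{t=0}^{∞} γ^t · R π t and V_F π = ∑_{t=0}^{∞} γ^t · (R π t + F π t). Then for every π* ∈ Π: π* maximizes V_F over Π (i.e., V_F π ≤ V_F π* for all π ∈ Π) if and only if π* maximizes V over Π. -/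
/-- The discounted potential-based shaping rewards telescope to a constant that depends only on
the initial potential. -/
theorem hasSum_discounted_shaping {γ : ℝ} (hγ0 : 0 < γ) (hγ1 : γ < 1) (φ0 : ℝ) {Φ F : ℕ → ℝ}
    (hΦ : ∃ C : ℝ, ∀ t : ℕ, |Φ t| ≤ C) (hF0 : F 0 = Φ 0 - γ⁻¹ * φ0)
    (hFsucc : ∀ t : ℕ, F (t + 1) = Φ (t + 1) - γ⁻¹ * Φ t) :
    HasSum (fun t : ℕ => γ ^ t * F t) (-(γ⁻¹ * φ0)) := by
  obtain ⟨C, hC⟩ := hΦ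
  have hsum : Summable (fun t : ℕ => γ ^ t * Φ t) := by
    refine Summable.of_norm_bounded
      ((summable_geometric_of_lt_one hγ0.le hγ1).mul_right C) fun t => ?_
    rw [Real.norm_eq_abs, abs_mul, abs_of_pos (pow_pos hγ0 t)]
    exact mul_le_mul_of_nonneg_left (hC t) (pow_pos hγ0 t).le
  have htail : HasSum (fun t : ℕ => γ ^ (t + 1) * F (t + 1)) (-Φ 0) := by
    have h := ((hasSum_nat_add_iff' 1).mpr hsum.hasSum).sub hsum.hasSum
    have hterm (t : ℕ) : γ ^ (t + 1) * F (t + 1) = γ ^ (t + 1) * Φ (t + 1) - γ ^ t * Φ t := by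
      rw [hFsucc]
      field_simp
      ring
    simpa [hterm] using h
  refine (hasSum_nat_add_iff' 1).mp ?_
  have hval : -(γ⁻¹ * φ0) - ∑ i ∈ Finset.range 1, γ ^ i * F i = -Φ 0 := by
    simp [hF0]
    ring
  rwa [hval]

/-- Proposition 1 (optimal-policy invariance of potential-based language reward
shaping, deterministic-policy setting): a policy maximizes the shaped discounted
return `V_F` over the policy set iff it maximizes the original discounted return `V`. -/
theorem potential_shaping_preserves_optimal_policies
    {Pol : Type*} [Nonempty Pol] (γ : ℝ) (hγ0 : 0 < γ) (hγ1 : γ < 1) (φ0 : ℝ)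
    (R : Pol → ℕ → ℝ) (hR : ∀ π : Pol, Summable (fun t : ℕ => γ ^ t * R π t))
    (Φ : Pol → ℕ → ℝ) (hΦ : ∀ π : Pol, ∃ C : ℝ, ∀ t : ℕ, |Φ π t| ≤ C)
    (F : Pol → ℕ → ℝ)
    (hF0 : ∀ π : Pol, F π 0 = Φ π 0 - γ⁻¹ * φ0)
    (hFsucc : ∀ π : Pol, ∀ t : ℕ, F π (t + 1) = Φ π (t + 1) - γ⁻¹ * Φ π t)
    (V VF : Pol → ℝ)
    (hV : ∀ π : Pol, V π = ∑' t : ℕ, γ ^ t * R π t)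
    (hVF : ∀ π : Pol, VF π = ∑' t : ℕ, γ ^ t * (R π t + F π t)) :
    ∀ πstar : Pol, (∀ π : Pol, VF π ≤ VF πstar) ↔ (∀ π : Pol, V π ≤ V πstar) := by
  have key : ∀ π : Pol, VF π = V π + -(γ⁻¹ * φ0) := fun π => by
    rw [hVF, hV]
    simp_rw [mul_add]
    exact ((hR π).hasSum.add
      (hasSum_discounted_shaping hγ0 hγ1 φ0 (hΦ π) (hF0 π) (hFsucc π))).tsum_eq
  intro πstar
  simp_rw [key, add_le_add_iff_right]
end
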